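/- Let A ⊂ ℤ≥0² be a finite set with |A| ≤ 6 and let S be a lower set with |S| = (p+1)(q+1)|A|. If (A,S) is almost regular with respect to (p,q)-rectangular sets of nodes, then S = T^{p,q} for some lower set T. -/

import Mathlib

open Finset

/-- A finite subset of `ℤ≥0²` is a *lower set* if it is closed under
coordinatewise decrease. -/
def IsLower (S : Finset (ℕ × ℕ)) : Prop :=
  ∀ u v, (u, v) ∈ S → ∀ i j, i ≤ u → j ≤ v → (i, j) ∈ S

/-- The value at `(x,y)` of `∂^{i+j}P/∂x^i∂y^j`, where `P` is the polynomial
with coefficients `a` supported on `S`. -/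
noncomputable def derivAt (S : Finset (ℕ × ℕ)) (a : ℕ × ℕ → ℝ) (i j : ℕ) (x y : ℝ) : ℝ :=
  ∑ uv ∈ S, a uv * (uv.1.descFactorial i : ℝ) * (uv.2.descFactorial j : ℝ) *
      x ^ (uv.1 - i) * y ^ (uv.2 - j)

/-- The bivariate Birkhoff scheme `(Z,A,S)` is *regular*: every interpolation
problem has a unique solution in `P_S` (polynomials supported on `S`). -/
def Regular (Z : Finset (ℝ × ℝ)) (A S : Finset (ℕ × ℕ)) : Prop :=
  ∀ c : ℕ × ℕ → ℝ × ℝ → ℝ, ∃! a : ℕ × ℕ → ℝ,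
    (∀ uv, uv ∉ S → a uv = 0) ∧
    ∀ z ∈ Z, ∀ ij ∈ A, derivAt S a ij.1 ij.2 z.1 z.2 = c ij z

/-- The scheme `(Z,A,S)` is *solvable*: every interpolation problem has at
least one solution in `P_S`. -/
def Solvable (Z : Finset (ℝ × ℝ)) (A S : Finset (ℕ × ℕ)) : Prop :=
  ∀ c : ℕ × ℕ → ℝ × ℝ → ℝ, ∃ a : ℕ × ℕ → ℝ,
    (∀ uv, uv ∉ S → a uv = 0) ∧
    ∀ z ∈ Z, ∀ ij ∈ A, derivAt S a ij.1 ij.2 z.1 z.2 = c ij z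

/-- `Z ⊂ ℝ²` is a `(p,q)`-rectangular set of nodes. -/
def IsRect (p q : ℕ) (Z : Finset (ℝ × ℝ)) : Prop :=
  ∃ x : Fin (p + 1) → ℝ, ∃ y : Fin (q + 1) → ℝ,
    Function.Injective x ∧ Function.Injective y ∧
    Z = (Finset.univ : Finset (Fin (p + 1) × Fin (q + 1))).image (fun ij => (x ij.1, y ij.2))

/-- `B_x = {i : (i,0) ∈ B}`. -/
def setX (B : Finset (ℕ × ℕ)) : Finset ℕ := (B.filter fun ij => ij.2 = 0).image Prod.fst

/-- `B_y = {j : (0,j) ∈ B}`. -/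
def setY (B : Finset (ℕ × ℕ)) : Finset ℕ := (B.filter fun ij => ij.1 = 0).image Prod.snd

/-- `B_x[β] = {α : (α,β) ∈ B}`. -/
def sliceX (B : Finset (ℕ × ℕ)) (b : ℕ) : Finset ℕ := (B.filter fun ij => ij.2 = b).image Prod.fst

/-- `B_y[α] = {β : (α,β) ∈ B}`. -/
def sliceY (B : Finset (ℕ × ℕ)) (a : ℕ) : Finset ℕ := (B.filter fun ij => ij.1 = a).image Prod.snd

/-- Projection of the nodes on the OX axis. -/
noncomputable def nodesX (Z : Finset (ℝ × ℝ)) : Finset ℝ := Z.image Prod.fst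

/-- Projection of the nodes on the OY axis. -/
noncomputable def nodesY (Z : Finset (ℝ × ℝ)) : Finset ℝ := Z.image Prod.snd

/-- The rectangle `R(u,v) = {(i,j) : i ≤ u, j ≤ v}`. -/
def rect (u v : ℕ) : Finset (ℕ × ℕ) := Finset.range (u + 1) ×ˢ Finset.range (v + 1)

/-- The blow-up `R^{p,q} = {(α,β) : (⌊α/(p+1)⌋, ⌊β/(q+1)⌋) ∈ R}`. -/
def blowup (p q : ℕ) (R : Finset (ℕ × ℕ)) : Finset (ℕ × ℕ) :=
  (R ×ˢ (Finset.range (p + 1) ×ˢ Finset.range (q + 1))).image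
    (fun x => ((p + 1) * x.1.1 + x.2.1, (q + 1) * x.1.2 + x.2.2))

/-- `n_{p,q}(L)`: number of `(α,β) ∈ L` with `(p+1) ∣ α` and `(q+1) ∣ β`. -/
def npq (p q : ℕ) (L : Finset (ℕ × ℕ)) : ℕ :=
  (L.filter fun ab => (p + 1) ∣ ab.1 ∧ (q + 1) ∣ ab.2).card

/-- Value at `x` of the `i`-th derivative of the univariate polynomial with
coefficients `a` supported on `S`. -/
noncomputable def derivAt1 (S : Finset ℕ) (a : ℕ → ℝ) (i : ℕ) (x : ℝ) : ℝ :=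
  ∑ u ∈ S, a u * (u.descFactorial i : ℝ) * x ^ (u - i)

/-- Regularity of the univariate Birkhoff scheme `(W,A,S)`. -/
def Regular1 (W : Finset ℝ) (A S : Finset ℕ) : Prop :=
  ∀ c : ℕ → ℝ → ℝ, ∃! a : ℕ → ℝ,
    (∀ u, u ∉ S → a u = 0) ∧
    ∀ w ∈ W, ∀ i ∈ A, derivAt1 S a i w = c i w

/-- `(A,S)` is almost regular with respect to `(p,q)`-rectangular sets of nodes. -/
def AlmostRegular (p q : ℕ) (A S : Finset (ℕ × ℕ)) : Prop :=
  ∃ Z : Finset (ℝ × ℝ), IsRect p q Z ∧ Regular Z A S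


/-- Regularity of `(Z, A, S)` for the grid `Z` with coordinates `x`, `y`, indexed by the grid. -/
def GridRegular {P Q : ℕ} (x : Fin P → ℝ) (y : Fin Q → ℝ) (A S : Finset (ℕ × ℕ)) : Prop :=
  (∀ c : ℕ × ℕ → Fin P → Fin Q → ℝ, ∃ a : ℕ × ℕ → ℝ, (∀ uv, uv ∉ S → a uv = 0) ∧
    ∀ k l, ∀ ij ∈ A, derivAt S a ij.1 ij.2 (x k) (y l) = c ij k l) ∧
  ∀ a : ℕ × ℕ → ℝ, (∀ uv, uv ∉ S → a uv = 0) →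
    (∀ k l, ∀ ij ∈ A, derivAt S a ij.1 ij.2 (x k) (y l) = 0) → a = 0

theorem AlmostRegular.exists_gridRegular {p q : ℕ} {A S : Finset (ℕ × ℕ)}
    (h : AlmostRegular p q A S) :
    ∃ (x : Fin (p + 1) → ℝ) (y : Fin (q + 1) → ℝ), GridRegular x y A S := by
  obtain ⟨Z, ⟨x, y, hx, hy, rfl⟩, hR⟩ := h
  refine ⟨x, y, fun c => ?_, fun a ha h0 => ?_⟩
  · obtain ⟨a, ⟨ha, hac⟩, -⟩ :=
      hR fun ij z => c ij (Function.invFun x z.1) (Function.invFun y z.2)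
    refine ⟨a, ha, fun k l ij hij => ?_⟩
    have := hac (x k, y l) (Finset.mem_image.2 ⟨(k, l), Finset.mem_univ _, rfl⟩) ij hij
    simpa [Function.leftInverse_invFun hx k, Function.leftInverse_invFun hy l] using this
  · refine (hR fun _ _ => 0).unique ⟨ha, fun z hz ij hij => ?_⟩
      ⟨fun _ _ => rfl, fun z _ ij _ => by simp [derivAt]⟩
    obtain ⟨kl, -, rfl⟩ := Finset.mem_image.1 hz
    exact h0 _ _ ij hij

theorem derivAt_swap (S : Finset (ℕ × ℕ)) (a : ℕ × ℕ → ℝ) (i j : ℕ) (x y : ℝ) :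
    derivAt (S.image Prod.swap) a j i y x = derivAt S (a ∘ Prod.swap) i j x y := by
  unfold derivAt
  rw [Finset.sum_image Prod.swap_injective.injOn]
  refine Finset.sum_congr rfl fun uv _ => ?_
  simp only [Function.comp, Prod.fst_swap, Prod.snd_swap]
  ring

theorem mem_image_swap {S : Finset (ℕ × ℕ)} {u v : ℕ} :
    (u, v) ∈ S.image Prod.swap ↔ (v, u) ∈ S := by
  simp [Prod.ext_iff]

theorem IsLower.swap {S : Finset (ℕ × ℕ)} (hS : IsLower S) : IsLower (S.image Prod.swap) :=
  fun u v huv i j hi hj => mem_image_swap.2 (hS v u (mem_image_swap.1 huv) j i hj hi)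

theorem GridRegular.swap {P Q : ℕ} {x : Fin P → ℝ} {y : Fin Q → ℝ} {A S : Finset (ℕ × ℕ)}
    (h : GridRegular x y A S) :
    GridRegular y x (A.image Prod.swap) (S.image Prod.swap) := by
  constructor
  · intro c
    obtain ⟨a, ha, hac⟩ := h.1 fun ij k l => c ij.swap l k
    refine ⟨a ∘ Prod.swap, fun uv huv => ha _ fun h' => huv (mem_image_swap.2 h'), ?_⟩
    intro k l ij hij
    rw [derivAt_swap]
    simpa [Function.comp_def] using hac l k ij.swap (mem_image_swap.1 hij)
  · intro a ha h0
    have := h.2 (a ∘ Prod.swap) (fun uv huv => ha _ fun h' => huv (mem_image_swap.1 h'))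
      fun k l ij hij => by
        rw [← derivAt_swap]
        exact h0 l k ij.swap (mem_image_swap.2 hij)
    funext uv
    exact congrFun this uv.swap

/-- On a product of coefficient sequences supported in a rectangle, derivatives factor. -/
theorem derivAt_mul {S : Finset (ℕ × ℕ)} {n m : ℕ} (hS : Finset.range n ×ˢ Finset.range m ⊆ S)
    {f g : ℕ → ℝ} (hf : ∀ u, n ≤ u → f u = 0) (hg : ∀ v, m ≤ v → g v = 0) (i j : ℕ) (x y : ℝ) :
    derivAt S (fun uv => f uv.1 * g uv.2) i j x y =
      derivAt1 (Finset.range n) f i x * derivAt1 (Finset.range m) g j y := by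
  unfold derivAt derivAt1
  rw [Finset.sum_mul_sum, ← Finset.sum_product', ← Finset.sum_subset hS]
  · exact Finset.sum_congr rfl fun uv _ => by ring
  · intro uv _ huv
    rw [Finset.mem_product, Finset.mem_range, Finset.mem_range, not_and_or, not_lt, not_lt] at huv
    rcases huv with h | h
    · simp [hf _ h]
    · simp [hg _ h]

theorem GridRegular.eq_zero_or_eq_zero {P Q : ℕ} {x : Fin P → ℝ} {y : Fin Q → ℝ}
    {A S : Finset (ℕ × ℕ)} (h : GridRegular x y A S) {n m : ℕ}
    (hS : Finset.range n ×ˢ Finset.range m ⊆ S)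
    {f g : ℕ → ℝ} (hf : ∀ u, n ≤ u → f u = 0) (hg : ∀ v, m ≤ v → g v = 0)
    (hA : ∀ ij ∈ A, (∀ k, derivAt1 (Finset.range n) f ij.1 (x k) = 0) ∨
      ∀ l, derivAt1 (Finset.range m) g ij.2 (y l) = 0) : f = 0 ∨ g = 0 := by
  have h0 := h.2 (fun uv => f uv.1 * g uv.2)
    (fun uv huv => by
      have : ¬ (uv.1 < n ∧ uv.2 < m) := fun h' => huv (hS (by simpa using h'))
      rw [not_and_or, not_lt, not_lt] at this
      rcases this with h | h
      · simp [hf _ h]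
      · simp [hg _ h])
    (fun k l ij hij => by
      rw [derivAt_mul hS hf hg]
      rcases hA ij hij with h | h
      · simp [h k]
      · simp [h l])
  by_contra! hne
  obtain ⟨u, hu⟩ := Function.ne_iff.1 hne.1
  obtain ⟨v, hv⟩ := Function.ne_iff.1 hne.2
  exact mul_ne_zero hu hv (congrFun h0 (u, v))

theorem exists_ne_zero_derivAt1_eq_zero {P n : ℕ} (x : Fin P → ℝ) (I : Finset ℕ)
    (hn : P * I.card < n) :
    ∃ f : ℕ → ℝ, f ≠ 0 ∧ (∀ u, n ≤ u → f u = 0) ∧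
      ∀ i ∈ I, ∀ k, derivAt1 (Finset.range n) f i (x k) = 0 := by
  let φ : (Fin n → ℝ) →ₗ[ℝ] (I × Fin P → ℝ) :=
    { toFun := fun f ik =>
        ∑ u : Fin n, f u * ((u : ℕ).descFactorial ik.1 : ℝ) * x ik.2 ^ ((u : ℕ) - ik.1)
      map_add' := fun f g => by
        funext ik
        simp [add_mul, Finset.sum_add_distrib]
      map_smul' := fun r f => by
        funext ik
        simp [Finset.mul_sum, mul_assoc] }
  have hker : LinearMap.ker φ ≠ ⊥ := LinearMap.ker_ne_bot_of_finrank_lt (by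
    simpa [mul_comm] using hn)
  obtain ⟨f, hf, hf0⟩ := Submodule.exists_mem_ne_zero_of_ne_bot hker
  refine ⟨fun u => if hu : u < n then f ⟨u, hu⟩ else 0, fun h0 => hf0 ?_, fun u hu => ?_,
    fun i hi k => ?_⟩
  · funext u
    simpa using congrFun h0 u
  · simp [not_lt.2 hu]
  · have := congrFun (LinearMap.mem_ker.1 hf) (⟨i, hi⟩, k)
    rw [derivAt1, Finset.sum_range]
    simpa [φ] using this

/-- No rectangle inside `S` is too large for a family of rows and columns covering `A`. -/
theorem GridRegular.not_subset_of_cover {P Q : ℕ} {x : Fin P → ℝ} {y : Fin Q → ℝ}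
    {A S : Finset (ℕ × ℕ)} (h : GridRegular x y A S) {I J : Finset ℕ}
    (hA : ∀ ij ∈ A, ij.1 ∈ I ∨ ij.2 ∈ J) {n m : ℕ} (hn : P * I.card < n) (hm : Q * J.card < m) :
    ¬ Finset.range n ×ˢ Finset.range m ⊆ S := by
  intro hS
  obtain ⟨f, hf0, hf, hfI⟩ := exists_ne_zero_derivAt1_eq_zero x I hn
  obtain ⟨g, hg0, hg, hgJ⟩ := exists_ne_zero_derivAt1_eq_zero y J hm
  rcases h.eq_zero_or_eq_zero hS hf hg
    (fun ij hij => (hA ij hij).imp (hfI _) (hgJ _)) with h | h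
  · exact hf0 h
  · exact hg0 h

theorem mem_setX {B : Finset (ℕ × ℕ)} {i : ℕ} : i ∈ setX B ↔ (i, 0) ∈ B := by
  simp [setX]

theorem mem_setY {B : Finset (ℕ × ℕ)} {j : ℕ} : j ∈ setY B ↔ (0, j) ∈ B := by
  simp [setY]

theorem setX_image_swap (B : Finset (ℕ × ℕ)) : setX (B.image Prod.swap) = setY B := by
  ext j
  rw [mem_setX, mem_setY, mem_image_swap]

theorem GridRegular.card_row_le {P Q : ℕ} {x : Fin P → ℝ} {y : Fin Q → ℝ}
    {A S : Finset (ℕ × ℕ)} (h : GridRegular x y A S) {N : ℕ} (hN : ∀ u, (u, 0) ∈ S ↔ u < N) :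
    N ≤ P * (setX A).card := by
  by_contra! hlt
  obtain ⟨f, hf0, hf, hfI⟩ := exists_ne_zero_derivAt1_eq_zero x (setX A) hlt
  rcases h.eq_zero_or_eq_zero (n := N) (m := 1) (g := Pi.single 0 1) (fun uv huv => by
      obtain ⟨u, v⟩ := uv
      simp only [Finset.mem_product, Finset.mem_range, Nat.lt_one_iff] at huv
      rw [huv.2]
      exact (hN u).2 huv.1) hf (fun v hv => Pi.single_eq_of_ne (by omega) _)
    (fun ij hij => by
      obtain ⟨i, j⟩ := ij
      rcases Nat.eq_zero_or_pos j with rfl | hj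
      · exact Or.inl (hfI i (mem_setX.2 hij))
      · right
        intro l
        simp [derivAt1, Nat.descFactorial_of_lt hj]) with h | h
  · exact hf0 h
  · simpa using congrFun h 0

/-- The first row of `S` has exactly `P` times as many points as that of `A`, and the next
`Q - 1` rows of `S` are equally long. -/
theorem GridRegular.first_rows {P Q : ℕ} (hQ : 0 < Q) {x : Fin P → ℝ} {y : Fin Q → ℝ}
    {A S : Finset (ℕ × ℕ)} (h : GridRegular x y A S) (hS : IsLower S) {N M : ℕ}
    (hN : ∀ u, (u, 0) ∈ S ↔ u < N) (hM : ∀ v, (0, v) ∈ S ↔ v < M) :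
    N = P * (setX A).card ∧ ∀ u < N, ∀ v < Q, (u, v) ∈ S := by
  have hsub : S ⊆ Finset.range N ×ˢ Finset.range M := fun uv huv => by
    simp only [Finset.mem_product, Finset.mem_range]
    exact ⟨(hN _).1 (hS _ _ huv _ _ le_rfl (Nat.zero_le _)),
      (hM _).1 (hS _ _ huv _ _ (Nat.zero_le _) le_rfl)⟩
  let φ : (Fin N × Fin Q → ℝ) →ₗ[ℝ] (setX A × Fin P × Fin Q → ℝ) :=
    { toFun := fun b ikl =>
        ∑ u : Fin N, b (u, ikl.2.2) * ((u : ℕ).descFactorial ikl.1 : ℝ) *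
          x ikl.2.1 ^ ((u : ℕ) - ikl.1)
      map_add' := fun f g => by
        funext ik
        simp [add_mul, Finset.sum_add_distrib]
      map_smul' := fun r f => by
        funext ik
        simp [Finset.mul_sum, mul_assoc] }
  have key : ∀ d, ∃ a : ℕ × ℕ → ℝ, (∀ uv, uv ∉ S → a uv = 0) ∧
      φ (fun ul => ∑ v ∈ Finset.range M, a (ul.1, v) * y ul.2 ^ v) = d := by
    intro d
    obtain ⟨a, ha, hac⟩ := h.1 fun ij k l =>
      if hi : ij.1 ∈ setX A then d (⟨ij.1, hi⟩, k, l) else 0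
    refine ⟨a, ha, ?_⟩
    funext ⟨⟨i, hi⟩, k, l⟩
    have := hac k l (i, 0) (mem_setX.1 hi)
    simp only [hi, dif_pos] at this
    rw [← this, derivAt, Finset.sum_subset hsub (fun uv _ huv => by simp [ha uv huv]),
      Finset.sum_product, Finset.sum_range]
    simp only [φ, LinearMap.coe_mk, AddHom.coe_mk]
    refine Finset.sum_congr rfl fun u _ => ?_
    rw [Finset.sum_mul, Finset.sum_mul]
    refine Finset.sum_congr rfl fun v _ => ?_
    simp
    ring
  have hsurj : Function.Surjective φ := fun d => by
    obtain ⟨a, -, had⟩ := key d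
    exact ⟨_, had⟩
  have hle := LinearMap.finrank_le_finrank_of_surjective hsurj
  have hNle := h.card_row_le hN
  simp only [Module.finrank_fintype_fun_eq_card, Fintype.card_prod, Fintype.card_fin,
    Fintype.card_coe] at hle
  have hNeq : N = P * (setX A).card := by
    refine le_antisymm hNle (Nat.le_of_mul_le_mul_right (c := Q) ?_ hQ)
    linarith
  refine ⟨hNeq, fun u hu v hv => ?_⟩
  have hinj : Function.Injective φ :=
    (LinearMap.injective_iff_surjective_of_finrank_eq_finrank (by
      simp only [Module.finrank_fintype_fun_eq_card, Fintype.card_prod, Fintype.card_fin,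
        Fintype.card_coe]
      rw [hNeq]
      ring)).2 hsurj
  by_contra hmem
  let ψ : (Fin v → ℝ) →ₗ[ℝ] (Fin Q → ℝ) :=
    { toFun := fun g l => ∑ w : Fin v, g w * y l ^ (w : ℕ)
      map_add' := fun f g => by
        funext l
        simp [add_mul, Finset.sum_add_distrib]
      map_smul' := fun r f => by
        funext l
        simp [Finset.mul_sum, mul_assoc] }
  have hψ : Function.Surjective ψ := fun e => by
    obtain ⟨a, ha, had⟩ := key (φ fun ul => e ul.2)
    refine ⟨fun w => a (u, w), ?_⟩
    funext l
    have hl := congrFun (hinj had) (⟨u, hu⟩, l)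
    simp only at hl
    rw [← hl]
    simp only [ψ, LinearMap.coe_mk, AddHom.coe_mk]
    rw [← Finset.sum_range fun w => a (u, w) * y l ^ w]
    have hzero : ∀ w, (u, w) ∉ S → a (u, w) * y l ^ w = 0 := fun w hw => by simp [ha _ hw]
    rw [← Finset.sum_filter_of_ne (p := fun w => (u, w) ∈ S) (s := Finset.range v)
        fun w _ hw => by_contra fun h' => hw (hzero w h'),
      ← Finset.sum_filter_of_ne (p := fun w => (u, w) ∈ S) (s := Finset.range M)
        fun w _ hw => by_contra fun h' => hw (hzero w h')]
    refine Finset.sum_congr ?_ fun _ _ => rfl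
    ext w
    simp only [Finset.mem_filter, Finset.mem_range, and_congr_left_iff]
    refine fun hw => ⟨fun _ => (hM w).1 (hS _ _ hw _ _ (Nat.zero_le _) le_rfl), fun _ => ?_⟩
    by_contra! hvw
    exact hmem (hS _ _ hw _ _ le_rfl hvw)
  have := LinearMap.finrank_le_finrank_of_surjective hψ
  simp only [Module.finrank_fintype_fun_eq_card, Fintype.card_fin] at this
  omega

theorem IsLower.exists_row_length {S : Finset (ℕ × ℕ)} (hS : IsLower S) :
    ∃ N, ∀ u, (u, 0) ∈ S ↔ u < N := by
  have hex : ∃ u, u ∉ setX S := Infinite.exists_notMem_finset _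
  refine ⟨Nat.find hex, fun u => ?_⟩
  rw [Nat.lt_find_iff]
  refine ⟨fun hu m hm => not_not.2 (mem_setX.2 (hS _ _ hu _ _ hm le_rfl)), fun hu => ?_⟩
  exact mem_setX.1 (not_not.1 (hu u le_rfl))

theorem mem_blowup {p q : ℕ} {T : Finset (ℕ × ℕ)} {u v : ℕ} :
    (u, v) ∈ blowup p q T ↔ (u / (p + 1), v / (q + 1)) ∈ T := by
  simp only [blowup, Finset.mem_image, Finset.mem_product, Finset.mem_range, Prod.mk.injEq]
  constructor
  · rintro ⟨⟨⟨a, b⟩, c, d⟩, ⟨hT, hc, hd⟩, rfl, rfl⟩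
    simpa [Nat.mul_add_div, Nat.div_eq_of_lt hc, Nat.div_eq_of_lt hd] using hT
  · intro hT
    exact ⟨((u / (p + 1), v / (q + 1)), u % (p + 1), v % (q + 1)),
      ⟨hT, Nat.mod_lt _ p.succ_pos, Nat.mod_lt _ q.succ_pos⟩,
      Nat.div_add_mod _ _, Nat.div_add_mod _ _⟩

/-- A union of three blown-up rectangles at the origin is a blow-up. -/
theorem exists_eq_blowup_of_mem_iff {p q : ℕ} {S : Finset (ℕ × ℕ)} (a b c d e f : ℕ)
    (h : ∀ u v, (u, v) ∈ S ↔ (u < (p + 1) * a ∧ v < (q + 1) * b) ∨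
      (u < (p + 1) * c ∧ v < (q + 1) * d) ∨ (u < (p + 1) * e ∧ v < (q + 1) * f)) :
    ∃ T : Finset (ℕ × ℕ), IsLower T ∧ S = blowup p q T := by
  refine ⟨Finset.range a ×ˢ Finset.range b ∪ (Finset.range c ×ˢ Finset.range d ∪
    Finset.range e ×ˢ Finset.range f), fun u v huv i j hi hj => ?_, ?_⟩
  · simp only [Finset.mem_union, Finset.mem_product, Finset.mem_range] at huv ⊢
    omega
  · ext ⟨u, v⟩
    rw [h, mem_blowup]
    simp only [Finset.mem_union, Finset.mem_product, Finset.mem_range,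
      Nat.div_lt_iff_lt_mul (Nat.succ_pos _), mul_comm]

/-- The points of `A` on the two axes and off them, counted together. -/
theorem card_interior_add_le (A : Finset (ℕ × ℕ)) :
    (A.filter fun ij => ij.1 ≠ 0 ∧ ij.2 ≠ 0).card + (setX A).card + (setY A).card
      ≤ A.card + 1 := by
  have hX : (setX A).card ≤ (A.filter fun ij => ij.2 = 0).card := Finset.card_image_le
  have hY : (setY A).card ≤ (A.filter fun ij => ij.1 = 0).card := Finset.card_image_le
  have h1 := Finset.card_filter_add_card_filter_not (s := A) (fun ij => ij.1 ≠ 0 ∧ ij.2 ≠ 0)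
  have h2 := Finset.card_union_add_card_inter (A.filter fun ij => ij.2 = 0)
    (A.filter fun ij => ij.1 = 0)
  have h3 : (A.filter fun ij => ij.2 = 0) ∪ (A.filter fun ij => ij.1 = 0) =
      A.filter fun ij => ¬ (ij.1 ≠ 0 ∧ ij.2 ≠ 0) := by
    ext ij
    simp only [Finset.mem_union, Finset.mem_filter]
    tauto
  have h4 : ((A.filter fun ij => ij.2 = 0) ∩ (A.filter fun ij => ij.1 = 0)).card ≤ 1 := by
    refine Finset.card_le_one.2 fun s hs t ht => ?_
    simp only [Finset.mem_inter, Finset.mem_filter] at hs ht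
    exact Prod.ext (hs.2.2.trans ht.2.2.symm) (hs.1.2.trans ht.1.2.symm)
  rw [h3] at h2
  omega

/-- If at most one point of `A` is off the axes, then a column and two rows cover `A`. -/
theorem GridRegular.notMem_of_card_interior_le_one {P Q : ℕ} {x : Fin P → ℝ} {y : Fin Q → ℝ}
    {A S : Finset (ℕ × ℕ)} (h : GridRegular x y A S) (hS : IsLower S)
    (hA : (A.filter fun ij => ij.1 ≠ 0 ∧ ij.2 ≠ 0).card ≤ 1) : (P, 2 * Q) ∉ S := by
  intro hmem
  set B := A.filter fun ij => ij.1 ≠ 0 ∧ ij.2 ≠ 0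
  have hJ : (insert 0 (B.image Prod.snd)).card ≤ 2 :=
    (Finset.card_insert_le _ _).trans (Nat.succ_le_succ (Finset.card_image_le.trans hA))
  refine h.not_subset_of_cover (I := {0}) (J := insert 0 (B.image Prod.snd))
    (n := P + 1) (m := 2 * Q + 1) (fun ij hij => ?_) (by simp) (by nlinarith) fun uv huv => ?_
  · by_cases h1 : ij.1 = 0
    · simp [h1]
    · by_cases h2 : ij.2 = 0
      · simp [h2]
      · right
        exact Finset.mem_insert_of_mem
          (Finset.mem_image_of_mem _ (Finset.mem_filter.2 ⟨hij, h1, h2⟩))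
  · simp only [Finset.mem_product, Finset.mem_range] at huv
    exact hS _ _ hmem _ _ (by omega) (by omega)

theorem card_interior_image_swap (A : Finset (ℕ × ℕ)) :
    ((A.image Prod.swap).filter fun ij => ij.1 ≠ 0 ∧ ij.2 ≠ 0).card =
      (A.filter fun ij => ij.1 ≠ 0 ∧ ij.2 ≠ 0).card := by
  rw [Finset.filter_image, Finset.card_image_of_injective _ Prod.swap_injective]
  simp only [Prod.fst_swap, Prod.snd_swap, and_comm]

/-- if `|A| ≤ 6` and `(A,S)` is almost regular with respect to
`(p,q)`-rectangular sets of nodes, then `S` is a blow-up `T^{p,q}`. -/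
theorem small_A_blowup (p q : ℕ) (A S : Finset (ℕ × ℕ))
    (hS : IsLower S) (hA : A.card ≤ 6)
    (hcard : S.card = (p + 1) * (q + 1) * A.card)
    (h : AlmostRegular p q A S) :
    ∃ T : Finset (ℕ × ℕ), IsLower T ∧ S = blowup p q T := by
  obtain ⟨x, y, hR⟩ := h.exists_gridRegular
  obtain ⟨N, hN⟩ := hS.exists_row_length
  obtain ⟨M, hM'⟩ := hS.swap.exists_row_length
  have hM : ∀ v, (0, v) ∈ S ↔ v < M := fun v => by rw [← hM', mem_image_swap]
  obtain ⟨hNa, hrows⟩ := hR.first_rows q.succ_pos hS hN hM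
  obtain ⟨hMb, hcols'⟩ := hR.swap.first_rows p.succ_pos hS.swap hM'
    fun v => by rw [mem_image_swap, hN]
  have hcols : ∀ v < M, ∀ u < p + 1, (u, v) ∈ S := fun v hv u hu =>
    mem_image_swap.1 (hcols' v hv u hu)
  rw [setX_image_swap] at hMb
  have hcount := card_interior_add_le A
  have hcorner : (A.filter fun ij => ij.1 ≠ 0 ∧ ij.2 ≠ 0).card ≤ 1 →
      (p + 1, 2 * (q + 1)) ∉ S ∧ (2 * (p + 1), q + 1) ∉ S := fun h1 =>
    ⟨hR.notMem_of_card_interior_le_one hS h1, fun h' =>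
      hR.swap.notMem_of_card_interior_le_one hS.swap
        ((card_interior_image_swap A).trans_le h1) (mem_image_swap.2 h')⟩
  have hSN : ∀ u v, (u, v) ∈ S → u < N ∧ v < M := fun u v huv =>
    ⟨(hN _).1 (hS _ _ huv _ _ le_rfl (Nat.zero_le _)),
      (hM _).1 (hS _ _ huv _ _ (Nat.zero_le _) le_rfl)⟩
  rcases Nat.eq_zero_or_pos N with hN0 | hNpos
  · refine ⟨∅, by simp [IsLower], ?_⟩
    ext ⟨u, v⟩
    simp only [mem_blowup, Finset.notMem_empty, iff_false]
    intro huv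
    have := hSN u v huv
    omega
  have hMpos : 0 < M := (hM 0).1 ((hN 0).2 hNpos)
  obtain ⟨P, hP⟩ : ∃ P, p + 1 = P := ⟨_, rfl⟩
  obtain ⟨Q, hQ⟩ : ∃ Q, q + 1 = Q := ⟨_, rfl⟩
  simp only [Nat.succ_eq_add_one, hP, hQ] at hcard hNa hrows hMb hcols hcorner
  obtain ⟨a, ha⟩ : ∃ a, (setX A).card = a + 1 := Nat.exists_eq_succ_of_ne_zero fun h0 => by
    rw [h0] at hNa
    omega
  obtain ⟨b, hb⟩ : ∃ b, (setY A).card = b + 1 := Nat.exists_eq_succ_of_ne_zero fun h0 => by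
    rw [h0] at hMb
    omega
  rw [ha] at hNa hcount
  rw [hb] at hMb hcount
  obtain ⟨t, ht⟩ : ∃ t, A.card = a + b + 1 + t := Nat.exists_eq_add_of_le (by omega)
  rw [ht] at hA hcard hcount
  subst hNa hMb
  have hPpos : 0 < P := by omega
  have hQpos : 0 < Q := by omega
  set D := S.filter fun uv => P ≤ uv.1 ∧ Q ≤ uv.2 with hD
  have hmemD : ∀ u v, P ≤ u → Q ≤ v → ((u, v) ∈ S ↔ (u, v) ∈ D) := fun u v hu hv => by
    simp [hD, hu, hv]
  have hcardD : D.card = P * Q * t := by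
    have h1 := Finset.card_filter_add_card_filter_not (s := S)
      (fun uv => P ≤ uv.1 ∧ Q ≤ uv.2)
    have h2 : (S.filter fun uv => ¬ (P ≤ uv.1 ∧ Q ≤ uv.2)) =
        Finset.range (P * (a + 1)) ×ˢ Finset.range Q ∪
          Finset.range P ×ˢ Finset.Ico Q (Q * (b + 1)) := by
      ext ⟨u, v⟩
      have h3 := hSN u v
      have h4 := hrows u
      have h5 := hcols v
      simp only [Finset.mem_filter, Finset.mem_union, Finset.mem_product, Finset.mem_range,
        Finset.mem_Ico]
      constructor
      · rintro ⟨h6, h7⟩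
        have := h3 h6
        omega
      · rintro (⟨h6, h7⟩ | ⟨h6, h7, h8⟩)
        · exact ⟨h4 h6 v h7, by omega⟩
        · exact ⟨h5 h8 u h6, by omega⟩
    rw [h2, Finset.card_union_of_disjoint, Finset.card_product, Finset.card_product,
      Finset.card_range, Finset.card_range, Finset.card_range, Nat.card_Ico, hcard] at h1
    · have h3 : Q * (b + 1) - Q = Q * b := by rw [Nat.mul_succ, Nat.add_sub_cancel]
      rw [h3, ← hD] at h1
      linarith
    · rw [Finset.disjoint_left]
      rintro ⟨u, v⟩ h3 h4
      simp only [Finset.mem_product, Finset.mem_range, Finset.mem_Ico] at h3 h4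
      omega
  have hcardbox : ∀ c d, (Finset.Ico P (P * (c + 1)) ×ˢ Finset.Ico Q (Q * (d + 1))).card =
      P * Q * (c * d) := fun c d => by
    rw [Finset.card_product, Nat.card_Ico, Nat.card_Ico, Nat.mul_succ, Nat.mul_succ,
      Nat.add_sub_cancel, Nat.add_sub_cancel]
    ring
  have hDsub : D ⊆ Finset.Ico P (P * (a + 1)) ×ˢ Finset.Ico Q (Q * (b + 1)) := by
    rintro ⟨u, v⟩ huv
    rw [hD, Finset.mem_filter] at huv
    have := hSN u v huv.1
    simp only [Finset.mem_product, Finset.mem_Ico]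
    omega
  have htab : t ≤ a * b := by
    have := Finset.card_le_card hDsub
    rw [hcardD, hcardbox] at this
    exact Nat.le_of_mul_le_mul_left this (Nat.mul_pos hPpos hQpos)
  obtain ⟨c, d, hDeq⟩ : ∃ c d, D = Finset.Ico P (P * (c + 1)) ×ˢ Finset.Ico Q (Q * (d + 1)) := by
    rcases eq_or_ne t (a * b) with h1 | h1
    · exact ⟨a, b, Finset.eq_of_subset_of_card_le hDsub (by rw [hcardD, hcardbox, h1])⟩
    rcases Nat.lt_or_ge 1 t with h2 | h2
    · have h3 : 3 ≤ a * b := by omega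
      have h4 : a + b ≤ 3 := by omega
      have h5 : a ≤ 3 := by omega
      interval_cases a <;> omega
    rcases Nat.eq_zero_or_pos t with h3 | h3
    · refine ⟨0, 0, ?_⟩
      rw [h3, mul_zero, Finset.card_eq_zero] at hcardD
      simp [hcardD]
    · obtain ⟨h4, h5⟩ := hcorner (by omega)
      refine ⟨1, 1, Finset.eq_of_subset_of_card_le ?_ (by
        rw [hcardD, hcardbox]; exact Nat.mul_le_mul_left _ h3)⟩
      rintro ⟨u, v⟩ huv
      rw [hD, Finset.mem_filter] at huv
      have h6 : u < 2 * P := by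
        by_contra! h7
        exact h5 (hS _ _ huv.1 _ _ h7 huv.2.2)
      have h8 : v < 2 * Q := by
        by_contra! h7
        exact h4 (hS _ _ huv.1 _ _ huv.2.1 h7)
      simp only [Finset.mem_product, Finset.mem_Ico]
      omega
  have hinterior : ∀ u v, P ≤ u → Q ≤ v →
      ((u, v) ∈ S ↔ u < P * (c + 1) ∧ v < Q * (d + 1)) := fun u v hu hv => by
    rw [hmemD u v hu hv, hDeq]
    simp [hu, hv]
  have hrow : ∀ u, ∀ v < Q, ((u, v) ∈ S ↔ u < P * (a + 1)) := fun u v hv =>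
    ⟨fun huv => (hSN u v huv).1, fun hu => hrows u hu v hv⟩
  have hcol : ∀ u < P, ∀ v, ((u, v) ∈ S ↔ v < Q * (b + 1)) := fun u hu v =>
    ⟨fun huv => (hSN u v huv).2, fun hv => hcols v hv u hu⟩
  rcases Nat.eq_zero_or_pos (c * d) with hcd | hcd
  · refine exists_eq_blowup_of_mem_iff (a + 1) 1 1 (b + 1) 0 0 fun u v => ?_
    rw [hP, hQ]
    rcases Nat.lt_or_ge v Q with hv | hv
    · rw [hrow u v hv]
      have : Q * 1 ≤ Q * (b + 1) := Nat.mul_le_mul_left _ (by omega)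
      have : P * 1 ≤ P * (a + 1) := Nat.mul_le_mul_left _ (by omega)
      omega
    rcases Nat.lt_or_ge u P with hu | hu
    · rw [hcol u hu v]
      omega
    rw [hinterior u v hu hv]
    rcases Nat.mul_eq_zero.1 hcd with rfl | rfl <;> omega
  · refine exists_eq_blowup_of_mem_iff (a + 1) 1 1 (b + 1) (c + 1) (d + 1) fun u v => ?_
    rw [hP, hQ]
    have hbox : u < P * (c + 1) → v < Q * (d + 1) → (u, v) ∈ S := fun hu hv => by
      have hc : P * 2 ≤ P * (c + 1) :=
        Nat.mul_le_mul_left _ (Nat.succ_le_succ (Nat.pos_of_mul_pos_right hcd))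
      have hd : Q * 2 ≤ Q * (d + 1) :=
        Nat.mul_le_mul_left _ (Nat.succ_le_succ (Nat.pos_of_mul_pos_left hcd))
      exact hS _ _ ((hinterior (max u P) (max v Q) (le_max_right _ _) (le_max_right _ _)).2
        ⟨by omega, by omega⟩) _ _ (le_max_left _ _) (le_max_left _ _)
    constructor
    · intro huv
      have h1 := hSN u v huv
      have h2 := hinterior u v
      by_cases hu : P ≤ u
      · by_cases hv : Q ≤ v
        · exact Or.inr (Or.inr ((h2 hu hv).1 huv))
        · omega
      · omega
    · rintro (⟨hu, hv⟩ | ⟨hu, hv⟩ | ⟨hu, hv⟩)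
      · exact hrows u hu v (by omega)
      · exact hcols v hv u (by omega)
      · exact hbox hu hv
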